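/- Let k ≥ 2 and T'_k = (σ₁σ₃)^{2k−2}(σ₃σ₄Δ₃)(Δ₃σ₄)[(δ₃σ₄)(δ̃₃σ₄)]^{k−1}(δ₃σ₄σ₃σ₄) ∈ B₅. For each p in the set {σ₂σ₁, σ₂σ₃, σ₂σ₁σ₃, σ₂σ₃σ₄, σ₂σ₁σ₃σ₄}, the conjugate x = p⁻¹ T'_k p satisfies: Δ⁻¹ ≼ x, x is not positive, x ≼ Δ^{4k−1}, and ¬(x ≼ Δ^{4k−2}). In particular each such conjugate has canonical length 4k and does not belong to the super summit set of T'_k. -/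

import Mathlib

/-- Defining relations of the braid group on 5 strands, as elements of the
free group on four generators (generator `i` corresponds to `σ_{i+1}`). -/
def braidRels : Set (FreeGroup (Fin 4)) :=
  { r | (∃ i : Fin 3, r = FreeGroup.of i.castSucc * FreeGroup.of i.succ * FreeGroup.of i.castSucc *
          (FreeGroup.of i.succ * FreeGroup.of i.castSucc * FreeGroup.of i.succ)⁻¹) ∨
        (∃ i j : Fin 4, 2 ≤ |(i : ℤ) - (j : ℤ)| ∧
          r = FreeGroup.of i * FreeGroup.of j * (FreeGroup.of j * FreeGroup.of i)⁻¹) }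

/-- The Artin braid group on 5 strands. -/
abbrev B5 : Type := PresentedGroup braidRels

/-- The Artin generators (index `i` corresponds to `σ_{i+1}`). -/
def gen (i : Fin 4) : B5 := PresentedGroup.of i

def s1 : B5 := gen 0
def s2 : B5 := gen 1
def s3 : B5 := gen 2
def s4 : B5 := gen 3

/-- A braid is positive if it lies in the submonoid generated by `σ₁,…,σ₄`. -/
def IsPos (x : B5) : Prop := x ∈ Submonoid.closure (Set.range gen)

/-- Prefix order: `Pre x y` means `x ≼ y`, i.e. `x⁻¹ y` is positive. -/
def Pre (x y : B5) : Prop := IsPos (x⁻¹ * y)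

/-- The half twist `Δ = σ₁σ₂σ₃σ₄σ₁σ₂σ₃σ₁σ₂σ₁`. -/
def Δ : B5 := s1*s2*s3*s4*s1*s2*s3*s1*s2*s1

def δ3 : B5 := s2*s1
def Δ3 : B5 := s2*s1*s2
def δt3 : B5 := s1*s2

/-- A braid `s` is simple if `1 ≼ s ≼ Δ`. -/
def IsSimple (s : B5) : Prop := IsPos s ∧ Pre s Δ

/-- Two simple braids `s, t` are left-weighted if no generator `σᵢ` is such that
`s σᵢ` and `σᵢ⁻¹ t` are both simple. -/
def LeftWeighted (s t : B5) : Prop :=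
  ¬ ∃ i : Fin 4, IsSimple (s * gen i) ∧ IsSimple ((gen i)⁻¹ * t)

/-- The canonical length of `z`: the minimum of `q - p` over `p ≤ q` with
`Δ^p ≼ z` and `z ≼ Δ^q`. -/
noncomputable def canLen (z : B5) : ℕ :=
  sInf { n : ℕ | ∃ p q : ℤ, p ≤ q ∧ q - p = (n : ℤ) ∧ Pre (Δ ^ p) z ∧ Pre z (Δ ^ q) }

/-- `y` belongs to the super summit set of `x`:
`y` is conjugate to `x` and has minimal canonical length among conjugates of `x`. -/
def InSSS (x y : B5) : Prop :=
  IsConj x y ∧ ∀ z : B5, IsConj x z → canLen y ≤ canLen z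

/-- The braid `T_k = δ₃^{3k+1} σ₄^{2k+2} σ₃ σ₄^{2k-1}`. -/
def T (k : ℕ) : B5 := δ3 ^ (3*k+1) * s4 ^ (2*k+2) * s3 * s4 ^ (2*k-1)

/-- The braid `T'_k`, a rigid conjugate of `T_k`. -/
def T' (k : ℕ) : B5 :=
  (s1*s3)^(2*k-2) * (s3*s4*Δ3) * (Δ3*s4) * ((δ3*s4)*(δt3*s4))^(k-1) * (δ3*s4*s3*s4)

/-! ### Positive words and certified word equalities -/

section Words

open FreeMonoid (ofList)

/-- The braid represented by a positive word. -/
def braid : FreeMonoid (Fin 4) →* B5 := FreeMonoid.lift gen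

theorem isPos_iff_exists_braid {x : B5} : IsPos x ↔ ∃ w, braid w = x := by
  rw [IsPos, ← FreeMonoid.mrange_lift]
  rfl

theorem isPos_braid (w : FreeMonoid (Fin 4)) : IsPos (braid w) :=
  isPos_iff_exists_braid.2 ⟨w, rfl⟩

theorem IsPos.mul {x y : B5} (hx : IsPos x) (hy : IsPos y) : IsPos (x * y) :=
  Submonoid.mul_mem _ hx hy

theorem IsPos.pow {x : B5} (hx : IsPos x) (n : ℕ) : IsPos (x ^ n) :=
  Submonoid.pow_mem _ hx n

theorem gen_braid (i : Fin 3) :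
    gen i.castSucc * gen i.succ * gen i.castSucc = gen i.succ * gen i.castSucc * gen i.succ :=
  mul_inv_eq_one.1 (PresentedGroup.one_of_mem (rels := braidRels) (Or.inl ⟨i, rfl⟩))

theorem gen_comm {i j : Fin 4} (h : 2 ≤ |(i : ℤ) - (j : ℤ)|) : gen i * gen j = gen j * gen i :=
  mul_inv_eq_one.1 (PresentedGroup.one_of_mem (rels := braidRels) (Or.inr ⟨i, j, h, rfl⟩))

theorem gen_braid_of_adjacent {i j : Fin 4} (hij : i ≠ j) (h : ¬ 2 ≤ |(i : ℤ) - (j : ℤ)|) :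
    gen i * gen j * gen i = gen j * gen i * gen j := by
  have h0 := gen_braid 0
  have h1 := gen_braid 1
  have h2 := gen_braid 2
  fin_cases i <;> fin_cases j <;> first
    | exact absurd rfl hij
    | exact absurd (by decide) h
    | exact h0
    | exact h0.symm
    | exact h1
    | exact h1.symm
    | exact h2
    | exact h2.symm

/-- Divide a positive word on the left by the generator `i`; the first argument bounds the
recursion depth. -/
def divGen : ℕ → Fin 4 → List (Fin 4) → Option (List (Fin 4))
  | 0, _, _ => none
  | _ + 1, _, [] => none
  | n + 1, i, j :: u =>
    if i = j then some u
    else if 2 ≤ |(i : ℤ) - (j : ℤ)| then (divGen n i u).map (j :: ·)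
    else (divGen n i u).bind fun v => (divGen n j v).map fun v' => j :: i :: v'

theorem braid_cons (i : Fin 4) (u : List (Fin 4)) :
    braid (ofList (i :: u)) = gen i * braid (ofList u) := by
  simp [braid]

theorem braid_of_divGen {n : ℕ} {i : Fin 4} {w u : List (Fin 4)} (h : divGen n i w = some u) :
    braid (ofList w) = gen i * braid (ofList u) := by
  induction n generalizing i w u with
  | zero => simp [divGen] at h
  | succ n ih =>
    cases w with
    | nil => simp [divGen] at h
    | cons j w =>
      simp only [divGen] at h
      split_ifs at h with hij hfar
      · obtain rfl : w = u := by simpa using h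
        rw [braid_cons, hij]
      · obtain ⟨v, hv, rfl⟩ := Option.map_eq_some_iff.1 h
        rw [braid_cons, braid_cons, ih hv, ← mul_assoc, ← mul_assoc, gen_comm hfar]
      · obtain ⟨v, hv, h⟩ := Option.bind_eq_some_iff.1 h
        obtain ⟨v', hv', rfl⟩ := Option.map_eq_some_iff.1 h
        rw [braid_cons, braid_cons, braid_cons, ih hv, ih hv']
        simp only [← mul_assoc]
        rw [gen_braid_of_adjacent hij hfar]

/-- Divide a positive word on the left by another one, letter by letter. -/
def divWord (n : ℕ) : List (Fin 4) → List (Fin 4) → Option (List (Fin 4))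
  | [], w => some w
  | i :: a, w => (divGen n i w).bind (divWord n a)

theorem braid_of_divWord {n : ℕ} {a w u : List (Fin 4)} (h : divWord n a w = some u) :
    braid (ofList w) = braid (ofList a) * braid (ofList u) := by
  induction a generalizing w with
  | nil =>
    obtain rfl : w = u := by simpa [divWord] using h
    simp [braid]
  | cons i a ih =>
    obtain ⟨v, hv, h⟩ := Option.bind_eq_some_iff.1 h
    rw [braid_of_divGen hv, ih h, braid_cons, mul_assoc]

theorem braid_eq_of_divWord {n : ℕ} {a w : List (Fin 4)} (h : divWord n a w = some []) :
    braid (ofList a) = braid (ofList w) := by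
  rw [braid_of_divWord h]
  simp [braid]

end Words

/-! ### Garside structure -/

/-- A positive word for `Δ`. -/
def deltaWord : FreeMonoid (Fin 4) := FreeMonoid.ofList [0, 1, 2, 3, 0, 1, 2, 0, 1, 0]

theorem braid_deltaWord : braid deltaWord = Δ := by
  simp [braid, deltaWord, Δ, s1, s2, s3, s4, mul_assoc]

theorem isPos_Δ : IsPos Δ := braid_deltaWord ▸ isPos_braid _

theorem gen_mul_Δ (i : Fin 4) : gen i * Δ = Δ * gen i.rev := by
  have key : ∀ i : Fin 4, divWord 30 (i :: [0, 1, 2, 3, 0, 1, 2, 0, 1, 0])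
      ([0, 1, 2, 3, 0, 1, 2, 0, 1, 0] ++ [i.rev]) = some [] := by decide
  have h := braid_eq_of_divWord (key i)
  rwa [braid_cons, FreeMonoid.ofList_append, map_mul, ← deltaWord, braid_deltaWord,
    FreeMonoid.ofList_singleton, braid, FreeMonoid.lift_eval_of] at h

theorem IsPos.conj_Δ {z : B5} (hz : IsPos z) : IsPos (Δ⁻¹ * z * Δ) := by
  induction hz using Submonoid.closure_induction with
  | mem x hx =>
    obtain ⟨i, rfl⟩ := hx
    rw [mul_assoc, gen_mul_Δ, inv_mul_cancel_left]
    exact Submonoid.subset_closure ⟨_, rfl⟩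
  | one =>
    rw [mul_one, inv_mul_cancel]
    exact Submonoid.one_mem _
  | mul x y _ _ hx hy =>
    have h : Δ⁻¹ * (x * y) * Δ = (Δ⁻¹ * x * Δ) * (Δ⁻¹ * y * Δ) := by group
    exact h ▸ hx.mul hy

theorem IsPos.commute_Δ_sq {z : B5} (hz : IsPos z) : Commute (Δ ^ 2) z := by
  induction hz using Submonoid.closure_induction with
  | mem x hx =>
    obtain ⟨i, rfl⟩ := hx
    rw [Commute, SemiconjBy, pow_two, ← mul_assoc, gen_mul_Δ, mul_assoc Δ (gen _), gen_mul_Δ,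
      Fin.rev_rev, mul_assoc]
  | one => exact Commute.one_right _
  | mul x y _ _ hx hy => exact hx.mul_right hy

theorem canLen_le {z : B5} {m : ℕ} (h0 : IsPos z) (h : Pre z (Δ ^ m)) : canLen z ≤ m :=
  Nat.sInf_le ⟨0, m, by simp, by simp, by simpa [Pre] using h0, by simpa using h⟩

theorem canLen_eq {z : B5} {m : ℕ} (h1 : Pre Δ⁻¹ z) (h2 : ¬ IsPos z) (h3 : Pre z (Δ ^ (m + 1)))
    (h4 : ¬ Pre z (Δ ^ m)) : canLen z = m + 2 := by
  refine IsLeast.csInf_eq ⟨⟨-1, m + 1, by lia, by push_cast; ring, by simpa using h1,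
    by exact_mod_cast h3⟩, ?_⟩
  rintro n ⟨p, q, -, hn, hp, hq⟩
  have hp' : p < 0 := by
    by_contra! hp0
    lift p to ℕ using hp0
    apply h2
    have := (isPos_Δ.pow p).mul hp
    simpa using this
  have hq' : (m : ℤ) < q := by
    by_contra! hqm
    obtain ⟨j, hj⟩ := Int.le.dest hqm
    apply h4
    have := IsPos.mul hq (isPos_Δ.pow j)
    rwa [mul_assoc, ← zpow_natCast Δ j, ← zpow_add, hj, zpow_natCast] at this
  lia

/-! ### The Lawrence–Krammer representation at `q = 1 / 2`, up to scaling -/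

/-- The constant terms (in `t`) of the Lawrence–Krammer matrices of the generators at `q = 1 / 2`,
multiplied by `2`. Rows and columns are indexed by the pairs `12, 13, 14, 15, 23, 24, 25, 34, 35,
45`. -/
def krammerConst : Fin 4 → Matrix (Fin 10) (Fin 10) ℕ :=
  ![![![0, 0, 0, 0, 0, 0, 0, 0, 0, 0],
      ![0, 0, 0, 0, 2, 0, 0, 0, 0, 0],
      ![0, 0, 0, 0, 0, 2, 0, 0, 0, 0],
      ![0, 0, 0, 0, 0, 0, 2, 0, 0, 0],
      ![0, 1, 0, 0, 1, 0, 0, 0, 0, 0],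
      ![0, 0, 1, 0, 0, 1, 0, 0, 0, 0],
      ![0, 0, 0, 1, 0, 0, 1, 0, 0, 0],
      ![0, 0, 0, 0, 0, 0, 0, 2, 0, 0],
      ![0, 0, 0, 0, 0, 0, 0, 0, 2, 0],
      ![0, 0, 0, 0, 0, 0, 0, 0, 0, 2]],
    ![![1, 2, 0, 0, 0, 0, 0, 0, 0, 0],
      ![1, 0, 0, 0, 0, 0, 0, 0, 0, 0],
      ![0, 0, 2, 0, 0, 0, 0, 0, 0, 0],
      ![0, 0, 0, 2, 0, 0, 0, 0, 0, 0],
      ![0, 0, 0, 0, 0, 0, 0, 0, 0, 0],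
      ![0, 0, 0, 0, 0, 0, 0, 2, 0, 0],
      ![0, 0, 0, 0, 0, 0, 0, 0, 2, 0],
      ![0, 0, 0, 0, 0, 1, 0, 1, 0, 0],
      ![0, 0, 0, 0, 0, 0, 1, 0, 1, 0],
      ![0, 0, 0, 0, 0, 0, 0, 0, 0, 2]],
    ![![2, 0, 0, 0, 0, 0, 0, 0, 0, 0],
      ![0, 1, 2, 0, 0, 0, 0, 0, 0, 0],
      ![0, 1, 0, 0, 0, 0, 0, 0, 0, 0],
      ![0, 0, 0, 2, 0, 0, 0, 0, 0, 0],
      ![0, 0, 0, 0, 1, 2, 0, 0, 0, 0],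
      ![0, 0, 0, 0, 1, 0, 0, 0, 0, 0],
      ![0, 0, 0, 0, 0, 0, 2, 0, 0, 0],
      ![0, 0, 0, 0, 0, 0, 0, 0, 0, 0],
      ![0, 0, 0, 0, 0, 0, 0, 0, 0, 2],
      ![0, 0, 0, 0, 0, 0, 0, 0, 1, 1]],
    ![![2, 0, 0, 0, 0, 0, 0, 0, 0, 0],
      ![0, 2, 0, 0, 0, 0, 0, 0, 0, 0],
      ![0, 0, 1, 2, 0, 0, 0, 0, 0, 0],
      ![0, 0, 1, 0, 0, 0, 0, 0, 0, 0],
      ![0, 0, 0, 0, 2, 0, 0, 0, 0, 0],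
      ![0, 0, 0, 0, 0, 1, 2, 0, 0, 0],
      ![0, 0, 0, 0, 0, 1, 0, 0, 0, 0],
      ![0, 0, 0, 0, 0, 0, 0, 1, 2, 0],
      ![0, 0, 0, 0, 0, 0, 0, 1, 0, 0],
      ![0, 0, 0, 0, 0, 0, 0, 0, 0, 0]]]

/-- The coefficients of `t / 16` in the Lawrence–Krammer matrices of the generators at `q = 1 / 2`,
multiplied by `2`. -/
def krammerLin : Fin 4 → Matrix (Fin 10) (Fin 10) ℤ :=
  ![![![8, -8, -8, -8, 0, 0, 0, 0, 0, 0],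
      ![0, 0, 0, 0, 0, 0, 0, 0, 0, 0],
      ![0, 0, 0, 0, 0, 0, 0, 0, 0, 0],
      ![0, 0, 0, 0, 0, 0, 0, 0, 0, 0],
      ![0, 0, 0, 0, 0, 0, 0, 0, 0, 0],
      ![0, 0, 0, 0, 0, 0, 0, 0, 0, 0],
      ![0, 0, 0, 0, 0, 0, 0, 0, 0, 0],
      ![0, 0, 0, 0, 0, 0, 0, 0, 0, 0],
      ![0, 0, 0, 0, 0, 0, 0, 0, 0, 0],
      ![0, 0, 0, 0, 0, 0, 0, 0, 0, 0]],
    ![![0, 0, 0, 0, 0, 0, 0, 0, 0, 0],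
      ![0, 0, 0, 0, 0, 0, 0, 0, 0, 0],
      ![0, 0, 0, 0, 0, 0, 0, 0, 0, 0],
      ![0, 0, 0, 0, 0, 0, 0, 0, 0, 0],
      ![0, -4, 4, 4, 8, -8, -8, 0, 0, 0],
      ![0, 0, 0, 0, 0, 0, 0, 0, 0, 0],
      ![0, 0, 0, 0, 0, 0, 0, 0, 0, 0],
      ![0, 0, 0, 0, 0, 0, 0, 0, 0, 0],
      ![0, 0, 0, 0, 0, 0, 0, 0, 0, 0],
      ![0, 0, 0, 0, 0, 0, 0, 0, 0, 0]],
    ![![0, 0, 0, 0, 0, 0, 0, 0, 0, 0],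
      ![0, 0, 0, 0, 0, 0, 0, 0, 0, 0],
      ![0, 0, 0, 0, 0, 0, 0, 0, 0, 0],
      ![0, 0, 0, 0, 0, 0, 0, 0, 0, 0],
      ![0, 0, 0, 0, 0, 0, 0, 0, 0, 0],
      ![0, 0, 0, 0, 0, 0, 0, 0, 0, 0],
      ![0, 0, 0, 0, 0, 0, 0, 0, 0, 0],
      ![0, 0, -2, 2, 0, -4, 4, 8, -8, 0],
      ![0, 0, 0, 0, 0, 0, 0, 0, 0, 0],
      ![0, 0, 0, 0, 0, 0, 0, 0, 0, 0]],
    ![![0, 0, 0, 0, 0, 0, 0, 0, 0, 0],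
      ![0, 0, 0, 0, 0, 0, 0, 0, 0, 0],
      ![0, 0, 0, 0, 0, 0, 0, 0, 0, 0],
      ![0, 0, 0, 0, 0, 0, 0, 0, 0, 0],
      ![0, 0, 0, 0, 0, 0, 0, 0, 0, 0],
      ![0, 0, 0, 0, 0, 0, 0, 0, 0, 0],
      ![0, 0, 0, 0, 0, 0, 0, 0, 0, 0],
      ![0, 0, 0, 0, 0, 0, 0, 0, 0, 0],
      ![0, 0, 0, 0, 0, 0, 0, 0, 0, 0],
      ![0, 0, 0, -1, 0, 0, -2, 0, -4, 8]]]

/-- The constant terms `krammerConst`, with integer coefficients. -/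
def krammerConstZ (i : Fin 4) : Matrix (Fin 10) (Fin 10) ℤ := (krammerConst i).map Nat.cast

/-- The Lawrence–Krammer matrices of the generators at `q = 1 / 2` and `t = 16 s`, multiplied by
`2`. -/
def krammer (s : ℤ) (i : Fin 4) : Matrix (Fin 10) (Fin 10) ℤ := krammerConstZ i + s • krammerLin i

theorem braid_relation_of_coeffs {R : Type*} [Ring R] {a b c d : R}
    (h0 : a * c * a = c * a * c)
    (h1 : b * c * a + a * d * a + a * c * b = d * a * c + c * b * c + c * a * d)
    (h2 : b * d * a + b * c * b + a * d * b = d * b * c + d * a * d + c * b * d)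
    (h3 : b * d * b = d * b * d) (s : ℤ) :
    (a + s • b) * (c + s • d) * (a + s • b) = (c + s • d) * (a + s • b) * (c + s • d) := by
  simp only [add_mul, mul_add, smul_mul_assoc, mul_smul_comm, smul_add, smul_smul]
  linear_combination (norm := module) h0 + s • h1 + (s * s) • h2 + (s * s * s) • h3

theorem comm_relation_of_coeffs {R : Type*} [Ring R] {a b c d : R} (h0 : a * c = c * a)
    (h1 : b * c + a * d = d * a + c * b) (h2 : b * d = d * b) (s : ℤ) :
    (a + s • b) * (c + s • d) = (c + s • d) * (a + s • b) := by
  simp only [add_mul, mul_add, smul_mul_assoc, mul_smul_comm, smul_add, smul_smul]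
  linear_combination (norm := module) h0 + s • h1 + (s * s) • h2

theorem cubic_relation_of_coeffs {R : Type*} [Ring R] {a b : R}
    (h0 : a * a * a = a * a + (2 : ℤ) • a)
    (h1 : a * a * b + a * b * a + b * a * a + (8 : ℤ) • a + (16 : ℤ) • 1 =
      (8 : ℤ) • (a * a) + a * b + b * a + (2 : ℤ) • b)
    (h2 : a * b * b + b * a * b + b * b * a + (8 : ℤ) • b =
      (8 : ℤ) • (a * b) + (8 : ℤ) • (b * a) + b * b)
    (h3 : b * b * b = (8 : ℤ) • (b * b)) (s : ℤ) :
    (a + s • b) * ((1 + 8 * s) • (a + s • b) - (a + s • b) * (a + s • b) - (8 * s - 2) • 1) =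
      (16 * s) • 1 := by
  simp only [add_mul, mul_add, mul_sub, smul_mul_assoc, mul_smul_comm, smul_add, smul_smul, mul_one,
    ← mul_assoc]
  linear_combination (norm := module) - h0 - s • h1 - (s * s) • h2 - (s * s * s) • h3

set_option maxRecDepth 10000 in
theorem krammer_braid (s : ℤ) (i : Fin 3) :
    krammer s i.castSucc * krammer s i.succ * krammer s i.castSucc =
      krammer s i.succ * krammer s i.castSucc * krammer s i.succ :=
  braid_relation_of_coeffs (by decide +kernel +revert) (by decide +kernel +revert)
    (by decide +kernel +revert) (by decide +kernel +revert) s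

theorem krammer_comm_of_lt (s : ℤ) {i j : Fin 4} (h : i.val + 2 ≤ j.val) :
    krammer s i * krammer s j = krammer s j * krammer s i :=
  comm_relation_of_coeffs (by decide +kernel +revert) (by decide +kernel +revert)
    (by decide +kernel +revert) s

theorem krammer_comm (s : ℤ) {i j : Fin 4} (h : 2 ≤ |(i : ℤ) - (j : ℤ)|) :
    krammer s i * krammer s j = krammer s j * krammer s i := by
  rcases le_abs.1 h with h | h
  · exact (krammer_comm_of_lt s (by omega)).symm
  · exact krammer_comm_of_lt s (by omega)

theorem krammer_cubic (s : ℤ) (i : Fin 4) :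
    krammer s i * ((1 + 8 * s) • krammer s i - krammer s i * krammer s i - (8 * s - 2) • 1) =
      (16 * s) • 1 :=
  cubic_relation_of_coeffs (by decide +kernel +revert) (by decide +kernel +revert)
    (by decide +kernel +revert) (by decide +kernel +revert) s

/-- Extension of scalars from integer to rational matrices. -/
def toRat : Matrix (Fin 10) (Fin 10) ℤ →+* Matrix (Fin 10) (Fin 10) ℚ :=
  (Int.castRingHom ℚ).mapMatrix

theorem toRat_injective : Function.Injective toRat :=
  Matrix.map_injective Int.cast_injective

theorem isUnit_toRat_krammer {s : ℤ} (hs : s ≠ 0) (i : Fin 4) : IsUnit (toRat (krammer s i)) := by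
  have h := congrArg toRat (krammer_cubic s i)
  set x := (1 + 8 * s) • krammer s i - krammer s i * krammer s i - (8 * s - 2) • 1
  rw [map_mul, map_zsmul, map_one] at h
  have hs' : ((16 * s : ℤ) : ℚ) ≠ 0 := by exact_mod_cast mul_ne_zero (by norm_num) hs
  have h' : toRat (krammer s i) * (((16 * s : ℤ) : ℚ)⁻¹ • toRat x) = 1 := by
    rw [mul_smul_comm, h, ← Int.cast_smul_eq_zsmul ℚ, smul_smul, inv_mul_cancel₀ hs', one_smul]
  exact IsUnit.of_mul_eq_one _ h'

/-- The Lawrence–Krammer representation at `q = 1 / 2` and `t = 16 s`, up to scaling. -/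
noncomputable def krammerRep {s : ℤ} (hs : s ≠ 0) : B5 →* (Matrix (Fin 10) (Fin 10) ℚ)ˣ :=
  PresentedGroup.toGroup (f := fun i => (isUnit_toRat_krammer hs i).unit) <| by
    rintro r (⟨i, rfl⟩ | ⟨i, j, hij, rfl⟩)
    · simp only [map_mul, map_inv, FreeGroup.lift_apply_of]
      rw [mul_inv_eq_one]
      ext1
      simp only [Units.val_mul, IsUnit.unit_spec, ← map_mul, krammer_braid]
    · simp only [map_mul, map_inv, FreeGroup.lift_apply_of]
      rw [mul_inv_eq_one]
      ext1
      simp only [Units.val_mul, IsUnit.unit_spec, ← map_mul, krammer_comm s hij]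

theorem krammerRep_gen {s : ℤ} (hs : s ≠ 0) (i : Fin 4) :
    (krammerRep hs (gen i) : Matrix (Fin 10) (Fin 10) ℚ) = toRat (krammer s i) := by
  simp [krammerRep, gen]

theorem krammerRep_braid {s : ℤ} (hs : s ≠ 0) (w : FreeMonoid (Fin 4)) :
    (krammerRep hs (braid w) : Matrix (Fin 10) (Fin 10) ℚ) =
      toRat (FreeMonoid.lift (krammer s) w) := by
  have h : (Units.coeHom _).comp ((krammerRep hs).comp braid) =
      (toRat : _ →* _).comp (FreeMonoid.lift (krammer s)) :=
    FreeMonoid.hom_eq fun i => by simp [braid, krammerRep_gen]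
  exact DFunLike.congr_fun h w

theorem lift_krammer_eq_of_braid_eq {s : ℤ} (hs : s ≠ 0) {v w : FreeMonoid (Fin 4)}
    (h : braid v = braid w) :
    FreeMonoid.lift (krammer s) v = FreeMonoid.lift (krammer s) w := by
  apply toRat_injective
  rw [← krammerRep_braid hs, h, krammerRep_braid hs]

/-- The constant term of the representation on positive words. -/
def krammerZero : FreeMonoid (Fin 4) →* Matrix (Fin 10) (Fin 10) ℕ := FreeMonoid.lift krammerConst

theorem lift_krammer_mod (n : ℕ) (w : FreeMonoid (Fin 4)) :
    (Int.castRingHom (ZMod n)).mapMatrix (FreeMonoid.lift (krammer n) w) =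
      (Nat.castRingHom (ZMod n)).mapMatrix (krammerZero w) := by
  have h : (RingHom.toMonoidHom (Int.castRingHom (ZMod n)).mapMatrix).comp
        (FreeMonoid.lift (krammer n)) =
      (RingHom.toMonoidHom (Nat.castRingHom (ZMod n)).mapMatrix).comp krammerZero :=
    FreeMonoid.hom_eq fun i => by
      ext a b
      have h : krammer n i a b = (krammerConst i a b : ℤ) + n * krammerLin i a b := rfl
      simp [krammerZero, h]
  exact DFunLike.congr_fun h w

/-! ### Supports of the constant terms -/

/-- The indices reached from those in `l` along the letters of a word. -/
def reach (l : List (Fin 10)) (w : List (Fin 4)) : List (Fin 10) :=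
  w.foldl (fun l i => (List.finRange 10).filter fun b => ∃ a ∈ l, 0 < krammerConst i a b) l

theorem mul_apply_pos_iff {ι : Type*} [Fintype ι] {M N : Matrix ι ι ℕ} {a c : ι} :
    0 < (M * N) a c ↔ ∃ b, 0 < M a b ∧ 0 < N b c := by
  simp [Matrix.mul_apply, Finset.sum_pos_iff]

theorem mem_reach {l : List (Fin 10)} {w : List (Fin 4)} {b : Fin 10} :
    b ∈ reach l w ↔ ∃ a ∈ l, 0 < krammerZero (FreeMonoid.ofList w) a b := by
  induction w generalizing l with
  | nil =>
    have h : ∀ a, (0 < if a = b then 1 else 0) ↔ a = b := by grind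
    simp [reach, krammerZero, Matrix.one_apply, h]
  | cons i w ih =>
    have h : krammerZero (FreeMonoid.ofList (i :: w)) =
        krammerConst i * krammerZero (FreeMonoid.ofList w) := by
      simp [krammerZero]
    rw [reach, List.foldl_cons, ← reach, ih, h]
    simp only [mul_apply_pos_iff, List.mem_filter, List.mem_finRange, true_and, decide_eq_true_eq]
    constructor
    · rintro ⟨c, ⟨a, ha, hac⟩, hcb⟩
      exact ⟨a, ha, c, hac, hcb⟩
    · rintro ⟨a, ha, c, hac, hcb⟩
      exact ⟨c, ⟨a, ha, hac⟩, hcb⟩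

theorem krammerZero_pos {w : List (Fin 4)} {a b : Fin 10} (h : b ∈ reach [a] w) :
    0 < krammerZero (FreeMonoid.ofList w) a b := by
  simpa [mem_reach] using h

theorem pow_apply_self_pos {ι : Type*} [Fintype ι] [DecidableEq ι] {M : Matrix ι ι ℕ} {a : ι}
    (h : 0 < M a a) (n : ℕ) : 0 < (M ^ n) a a := by
  induction n with
  | zero => simp
  | succ n ih => exact pow_succ M n ▸ mul_apply_pos_iff.2 ⟨a, ih, h⟩

theorem krammerZero_deltaWord : krammerZero deltaWord = 0 := by
  ext a b
  have key : ∀ a : Fin 10, reach [a] [0, 1, 2, 3, 0, 1, 2, 0, 1, 0] = [] := by decide +kernel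
  by_contra h
  have hb : b ∈ reach [a] [0, 1, 2, 3, 0, 1, 2, 0, 1, 0] :=
    mem_reach.2 ⟨a, List.mem_singleton_self a, Nat.pos_of_ne_zero h⟩
  rw [key] at hb
  exact List.not_mem_nil hb

/-- A positive braid divisible by `Δ` has vanishing constant term. -/
theorem krammerZero_eq_zero {y : FreeMonoid (Fin 4)} (h : IsPos (Δ⁻¹ * braid y)) :
    krammerZero y = 0 := by
  obtain ⟨w, hw⟩ := isPos_iff_exists_braid.1 h
  have hy : braid (deltaWord * w) = braid y := by
    rw [map_mul, hw, braid_deltaWord, mul_inv_cancel_left]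
  ext a b
  set n := krammerZero y a b + 1 with hn
  have h1 := lift_krammer_mod n y
  rw [← lift_krammer_eq_of_braid_eq (by lia) hy, lift_krammer_mod, map_mul, krammerZero_deltaWord,
    zero_mul, map_zero] at h1
  have h2 : ((krammerZero y a b : ℕ) : ZMod n) = 0 := (congrFun (congrFun h1 a) b).symm
  exact Nat.eq_zero_of_dvd_of_lt ((ZMod.natCast_eq_zero_iff _ _).1 h2) (by lia)

theorem not_isPos_of_reach {u x v y w : List (Fin 4)} {a b c d : Fin 10}
    (hu : b ∈ reach [a] u) (hx : b ∈ reach [b] x) (hv : c ∈ reach [b] v) (hy : c ∈ reach [c] y)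
    (hw : d ∈ reach [c] w) (n : ℕ) :
    ¬ IsPos (Δ⁻¹ * braid (FreeMonoid.ofList u * FreeMonoid.ofList x ^ n * FreeMonoid.ofList v *
      FreeMonoid.ofList y ^ n * FreeMonoid.ofList w)) := by
  intro h
  have h0 := krammerZero_eq_zero h
  have hpos : 0 < krammerZero (FreeMonoid.ofList u * FreeMonoid.ofList x ^ n *
      FreeMonoid.ofList v * FreeMonoid.ofList y ^ n * FreeMonoid.ofList w) a d := by
    simp only [map_mul, map_pow]
    exact mul_apply_pos_iff.2 ⟨c, mul_apply_pos_iff.2 ⟨c, mul_apply_pos_iff.2 ⟨b,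
      mul_apply_pos_iff.2 ⟨b, krammerZero_pos hu, pow_apply_self_pos (krammerZero_pos hx) n⟩,
      krammerZero_pos hv⟩, pow_apply_self_pos (krammerZero_pos hy) n⟩, krammerZero_pos hw⟩
  simp [h0] at hpos

/-! ### The braids `T' k` and their conjugates -/

section Conjugates

open FreeMonoid (ofList)

/-- A word for `(σ₁σ₃)²`. -/
def wordA : List (Fin 4) := [0, 2, 0, 2]

/-- A word for `(σ₃σ₄Δ₃)(Δ₃σ₄)`. -/
def wordB : List (Fin 4) := [2, 3, 1, 0, 1, 1, 0, 1, 3]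

/-- A word for `(δ₃σ₄)(δ̃₃σ₄)`. -/
def wordC : List (Fin 4) := [1, 0, 3, 0, 1, 3]

/-- A word for `δ₃σ₄σ₃σ₄`. -/
def wordF : List (Fin 4) := [1, 0, 3, 2, 3]

/-- The complement of `wordA` in `Δ ^ 2`. -/
def coA : List (Fin 4) := [1, 2, 0, 1, 3, 2, 1, 0, 0, 1, 2, 3, 1, 2, 0, 1]

/-- The complement of `wordB` in `Δ ^ 2`. -/
def coB : List (Fin 4) := [2, 3, 1, 2, 0, 1, 1, 2, 3, 0, 1]

/-- The complement of `wordC` in `Δ ^ 2`. -/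
def coC : List (Fin 4) := [0, 2, 3, 1, 2, 0, 1, 1, 2, 3, 0, 1, 2, 0]

/-- The product of all factors of `T' (n + 1)` but the last one. -/
def initT (n : ℕ) : FreeMonoid (Fin 4) := ofList wordA ^ n * ofList wordB * ofList wordC ^ n

/-- The complement of `initT n` in `Δ ^ (4 * n + 2)`. -/
def coInitT (n : ℕ) : FreeMonoid (Fin 4) := ofList coC ^ n * ofList coB * ofList coA ^ n

theorem T'_succ (n : ℕ) : T' (n + 1) = braid (initT n * ofList wordF) := by
  have h : 2 * (n + 1) - 2 = 2 * n := by lia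
  rw [T', h, pow_mul]
  simp [initT, wordA, wordB, wordC, wordF, braid, Δ3, δ3, δt3, s1, s2, s3, s4, mul_assoc, pow_two]

theorem braid_mul_complement {a b : List (Fin 4)}
    (h : divWord 40 (a ++ b)
      ([0, 1, 2, 3, 0, 1, 2, 0, 1, 0] ++ [0, 1, 2, 3, 0, 1, 2, 0, 1, 0]) = some []) :
    braid (ofList a) * braid (ofList b) = Δ ^ 2 := by
  have h' := braid_eq_of_divWord h
  rwa [FreeMonoid.ofList_append, FreeMonoid.ofList_append, map_mul, map_mul, ← deltaWord,
    braid_deltaWord, ← pow_two] at h'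

theorem pow_mul_pow_eq {G : Type*} [Group G] {x y z : G} (h : x * y = z) (hz : Commute z x) (n : ℕ) :
    x ^ n * y ^ n = z ^ n := by
  have hxy : Commute x y := by
    rw [eq_inv_mul_of_mul_eq h]
    exact (Commute.refl x).inv_right.mul_right hz.symm
  rw [← hxy.mul_pow, h]

theorem braid_initT_mul_coInitT (n : ℕ) :
    braid (initT n) * braid (coInitT n) = (Δ ^ 2) ^ (2 * n + 1) := by
  have hA := braid_mul_complement (a := wordA) (b := coA) (by decide +kernel)
  have hB := braid_mul_complement (a := wordB) (b := coB) (by decide +kernel)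
  have hC := braid_mul_complement (a := wordC) (b := coC) (by decide +kernel)
  have hA' := pow_mul_pow_eq hA (isPos_braid _).commute_Δ_sq n
  have hC' := pow_mul_pow_eq hC (isPos_braid _).commute_Δ_sq n
  have hB' := ((isPos_braid (ofList wordB)).commute_Δ_sq.pow_left n).eq
  have hz := (((isPos_braid (ofList wordA)).pow n).commute_Δ_sq.pow_left (n + 1)).eq
  simp only [initT, coInitT, map_mul, map_pow]
  calc _ = braid (ofList wordA) ^ n * (braid (ofList wordB) *
        (braid (ofList wordC) ^ n * braid (ofList coC) ^ n) * braid (ofList coB)) *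
        braid (ofList coA) ^ n := by group
    _ = braid (ofList wordA) ^ n * ((Δ ^ 2) ^ n * (braid (ofList wordB) * braid (ofList coB))) *
        braid (ofList coA) ^ n := by rw [hC', ← hB', mul_assoc ((Δ ^ 2) ^ n)]
    _ = (Δ ^ 2) ^ (n + 1) * (braid (ofList wordA) ^ n * braid (ofList coA) ^ n) := by
      rw [hB, ← pow_succ, ← hz, mul_assoc]
    _ = _ := by
      rw [hA', ← pow_add]
      congr 1
      lia

theorem conj_inv_mul {n : ℕ} {p g : List (Fin 4)} (hg : braid (ofList (g ++ wordF ++ p)) = Δ) :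
    ((braid (ofList p))⁻¹ * T' (n + 1) * braid (ofList p))⁻¹ * Δ ^ (4 * n + 2) =
      Δ⁻¹ * braid (ofList g * coInitT n * ofList p) := by
  have h1 : Δ ^ (4 * n + 2) = (Δ ^ 2) ^ (2 * n + 1) := by
    rw [← pow_mul]
    congr 1
    lia
  have h2 := ((isPos_braid (ofList p)).commute_Δ_sq.pow_left (2 * n + 1)).eq
  have h3 : ((braid (ofList p))⁻¹ * T' (n + 1) * braid (ofList p))⁻¹ * (Δ ^ 2) ^ (2 * n + 1) =
      (braid (ofList p))⁻¹ * (braid (ofList wordF))⁻¹ * (braid (initT n))⁻¹ *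
        (braid (ofList p) * (Δ ^ 2) ^ (2 * n + 1)) := by
    rw [T'_succ, map_mul]
    group
  rw [h1, h3, ← h2, ← braid_initT_mul_coInitT, ← hg]
  simp only [FreeMonoid.ofList_append, map_mul]
  group

theorem pre_conj {n : ℕ} {p g : List (Fin 4)} (hg : braid (ofList (g ++ wordF ++ p)) = Δ) :
    Pre ((braid (ofList p))⁻¹ * T' (n + 1) * braid (ofList p)) (Δ ^ (4 * n + 3)) := by
  rw [Pre, pow_succ Δ (4 * n + 2), ← mul_assoc, conj_inv_mul hg]
  exact (isPos_braid _).conj_Δ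

theorem canLen_T'_le (n : ℕ) : canLen (T' (n + 1)) ≤ 4 * n + 3 := by
  refine canLen_le (T'_succ n ▸ isPos_braid _) ?_
  have hg : braid (ofList ([2, 1, 0, 3, 2] ++ wordF ++ [])) = Δ :=
    (braid_eq_of_divWord (n := 30) (by decide +kernel)).trans braid_deltaWord
  simpa [braid] using pre_conj (n := n) hg

theorem conj_not_SSS {n : ℕ} {p r g : List (Fin 4)}
    (hr : divWord 30 (r ++ p) [0, 1, 2, 3, 0, 1, 2, 0, 1, 0] = some [])
    (hg : divWord 30 (g ++ wordF ++ p) [0, 1, 2, 3, 0, 1, 2, 0, 1, 0] = some [])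
    (hinf : ∃ a b c d, b ∈ reach [a] r ∧ b ∈ reach [b] wordA ∧ c ∈ reach [b] wordB ∧
      c ∈ reach [c] wordC ∧ d ∈ reach [c] (wordF ++ p))
    (hsup : ∃ a b c d, b ∈ reach [a] g ∧ b ∈ reach [b] coC ∧ c ∈ reach [b] coB ∧
      c ∈ reach [c] coA ∧ d ∈ reach [c] p)
    {x : B5} (hx : x = (braid (ofList p))⁻¹ * T' (n + 1) * braid (ofList p)) :
    Pre Δ⁻¹ x ∧ ¬ IsPos x ∧ Pre x (Δ ^ (4 * n + 3)) ∧ ¬ Pre x (Δ ^ (4 * n + 2)) ∧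
      canLen x = 4 * n + 4 ∧ ¬ InSSS (T' (n + 1)) x := by
  have hr' : braid (ofList (r ++ p)) = Δ := (braid_eq_of_divWord hr).trans braid_deltaWord
  have hg' : braid (ofList (g ++ wordF ++ p)) = Δ := (braid_eq_of_divWord hg).trans braid_deltaWord
  have hΔx : Δ * x = braid (ofList r * ofList wordA ^ n * ofList wordB * ofList wordC ^ n *
      ofList (wordF ++ p)) := by
    rw [hx, T'_succ, ← hr', initT]
    simp only [FreeMonoid.ofList_append, map_mul]
    group
  have h1 : Pre Δ⁻¹ x := by
    rw [Pre, inv_inv, hΔx]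
    exact isPos_braid _
  have h2 : ¬ IsPos x := by
    obtain ⟨a, b, c, d, h1, h2, h3, h4, h5⟩ := hinf
    have := not_isPos_of_reach h1 h2 h3 h4 h5 n
    rwa [← hΔx, inv_mul_cancel_left] at this
  have h3 : Pre x (Δ ^ (4 * n + 3)) := hx ▸ pre_conj hg'
  have h4 : ¬ Pre x (Δ ^ (4 * n + 2)) := by
    obtain ⟨a, b, c, d, h1, h2, h3, h4, h5⟩ := hsup
    have := not_isPos_of_reach h1 h2 h3 h4 h5 n
    rw [hx, Pre, conj_inv_mul hg', coInitT]
    simpa only [mul_assoc] using this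
  have h5 : canLen x = 4 * n + 4 := canLen_eq h1 h2 h3 h4
  refine ⟨h1, h2, h3, h4, h5, fun h => ?_⟩
  have h6 := (h.2 _ (IsConj.refl _)).trans (canLen_T'_le n)
  lia

end Conjugates

/-- for each `p ∈ {σ₂σ₁, σ₂σ₃, σ₂σ₁σ₃, σ₂σ₃σ₄, σ₂σ₁σ₃σ₄}`, the
conjugate `x = p⁻¹ T'_k p` satisfies `Δ⁻¹ ≼ x`, `x` is not positive,
`x ≼ Δ^{4k-1}`, `¬(x ≼ Δ^{4k-2})`; in particular it has canonical length `4k` and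
does not belong to the super summit set of `T'_k`. -/
theorem conj_prefixes_not_SSS (k : ℕ) (hk : 2 ≤ k) :
    ∀ p ∈ ([s2*s1, s2*s3, s2*s1*s3, s2*s3*s4, s2*s1*s3*s4] : List B5),
      Pre Δ⁻¹ (p⁻¹ * T' k * p) ∧ ¬ IsPos (p⁻¹ * T' k * p) ∧
      Pre (p⁻¹ * T' k * p) (Δ ^ (4*k-1)) ∧ ¬ Pre (p⁻¹ * T' k * p) (Δ ^ (4*k-2)) ∧
      canLen (p⁻¹ * T' k * p) = 4*k ∧
      ¬ InSSS (T' k) (p⁻¹ * T' k * p) := by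
  obtain ⟨n, rfl⟩ : ∃ n, k = n + 1 := ⟨k - 1, by lia⟩
  have e1 : 4 * (n + 1) - 1 = 4 * n + 3 := by lia
  have e2 : 4 * (n + 1) - 2 = 4 * n + 2 := by lia
  have e3 : 4 * (n + 1) = 4 * n + 4 := by lia
  rw [e1, e2, e3]
  intro p hp
  simp only [List.mem_cons, List.not_mem_nil, or_false] at hp
  rcases hp with rfl | rfl | rfl | rfl | rfl
  · exact conj_not_SSS (p := [1, 0]) (r := [2, 1, 0, 2, 1, 3, 2, 3]) (g := [1, 0, 2])
      (by decide +kernel) (by decide +kernel)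
      ⟨8, 4, 2, 7, by decide +kernel⟩ ⟨0, 4, 7, 2, by decide +kernel⟩
      (by simp [braid, s1, s2, mul_assoc])
  · exact conj_not_SSS (p := [1, 2]) (r := [3, 2, 1, 0, 1, 3, 2, 3]) (g := [0, 3, 2])
      (by decide +kernel) (by decide +kernel)
      ⟨4, 4, 7, 0, by decide +kernel⟩ ⟨1, 4, 7, 4, by decide +kernel⟩
      (by simp [braid, s2, s3, mul_assoc])
  · exact conj_not_SSS (p := [1, 0, 2]) (r := [2, 1, 0, 1, 3, 2, 3]) (g := [0, 2])
      (by decide +kernel) (by decide +kernel)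
      ⟨4, 4, 7, 4, by decide +kernel⟩ ⟨1, 4, 7, 1, by decide +kernel⟩
      (by simp [braid, s1, s2, s3, mul_assoc])
  · exact conj_not_SSS (p := [1, 2, 3]) (r := [3, 2, 1, 0, 3, 2, 3]) (g := [3, 2])
      (by decide +kernel) (by decide +kernel)
      ⟨0, 4, 7, 0, by decide +kernel⟩ ⟨1, 1, 7, 4, by decide +kernel⟩
      (by simp [braid, s2, s3, s4, mul_assoc])
  · exact conj_not_SSS (p := [1, 0, 2, 3]) (r := [2, 1, 0, 3, 2, 3]) (g := [2])
      (by decide +kernel) (by decide +kernel)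
      ⟨0, 4, 7, 4, by decide +kernel⟩ ⟨1, 1, 7, 1, by decide +kernel⟩
      (by simp [braid, s1, s2, s3, s4, mul_assoc])
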